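/- arXiv:1403.3521 — 6 statements merged into one kernel-verified Lean document; each statement's English description precedes it below -/
import Mathlib

section
/- Let f₁₁₁, f₁₁₂, f₁₂₂, f₂₁₁, f₂₁₂, f₂₂₂, R, S, T be real numbers with (R,S,T) ≠ (0,0,0), and let D = span{(1,0,f₁₁₁,f₁₁₂,f₁₂₂), (0,1,f₂₁₁,f₂₁₂,f₂₂₂), (0,0,R,S,T)} ⊆ ℝ⁵ (a 3-dimensional subspace whose intersection with V₀ is 1-dimensional). Then for every p = (p₁₁₁,p₁₁₂,p₁₂₂,p₂₂₂) ∈ ℝ⁴: L(p) ∩ D ≠ {0} if and only if det [[p₁₁₁−f₁₁₁, p₁₁₂−f₁₁₂, p₁₂₂−f₁₂₂], [p₁₁₂−f₂₁₁, p₁₂₂−f₂₁₂, p₂₂₂−f₂₂₂], [R, S, T]] = 0. -/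
/-- The first generator `D₁ + p₁₁₁∂p₁₁ + p₁₁₂∂p₁₂ + p₁₂₂∂p₂₂` of a Lagrangian plane. -/
def lag1 (p111 p112 p122 p222 : ℝ) : Fin 5 → ℝ := ![1, 0, p111, p112, p122]

/-- The second generator `D₂ + p₁₁₂∂p₁₁ + p₁₂₂∂p₁₂ + p₂₂₂∂p₂₂` of a Lagrangian plane. -/
def lag2 (p111 p112 p122 p222 : ℝ) : Fin 5 → ℝ := ![0, 1, p112, p122, p222]

/-- The Lagrangian plane `L(p) = span{ℓ₁(p), ℓ₂(p)} ⊆ ℝ⁵`. -/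
def lagPlane (p111 p112 p122 p222 : ℝ) : Submodule ℝ (Fin 5 → ℝ) :=
  Submodule.span ℝ {lag1 p111 p112 p122 p222, lag2 p111 p112 p122 p222}

/-- A fully nonlinear Goursat-type 3rd-order MAE: the Lagrangian plane `L(p)` meets the
3-dimensional distribution `D` (with 1-dimensional vertical part) nontrivially iff the
Goursat determinant (eqGoursat) vanishes. -/
theorem goursat_fully_nonlinear_iff_det
    (f111 f112 f122 f211 f212 f222 R S T : ℝ)
    (hRST : ¬(R = 0 ∧ S = 0 ∧ T = 0))
    (D : Submodule ℝ (Fin 5 → ℝ))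
    (hD : D = Submodule.span ℝ
      {![1, 0, f111, f112, f122], ![0, 1, f211, f212, f222], ![0, 0, R, S, T]}) :
    ∀ p111 p112 p122 p222 : ℝ,
      lagPlane p111 p112 p122 p222 ⊓ D ≠ ⊥ ↔
      Matrix.det !![p111 - f111, p112 - f112, p122 - f122;
                    p112 - f211, p122 - f212, p222 - f222;
                    R, S, T] = 0 := by
  intro p111 p112 p122 p222
  rw [← Matrix.exists_vecMul_eq_zero_iff, Submodule.ne_bot_iff]
  subst hD
  constructor
  · rintro ⟨x, hx, hx0⟩
    obtain ⟨hxL, hxD⟩ := Submodule.mem_inf.mp hx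
    obtain ⟨a, b, hab⟩ := Submodule.mem_span_pair.mp hxL
    obtain ⟨a', b', c, hD⟩ := Submodule.mem_span_triple.mp hxD
    have heq := hab.trans hD.symm
    have h0 := congrFun heq 0
    have h1 := congrFun heq 1
    have h2 := congrFun heq 2
    have h3 := congrFun heq 3
    have h4 := congrFun heq 4
    simp [lag1, lag2] at h0 h1 h2 h3 h4
    subst h0 h1
    refine ⟨![a, b, -c], fun hv => hx0 ?_, ?_⟩
    · have ha : a = 0 := congrFun hv 0
      have hb : b = 0 := congrFun hv 1
      simp [← hab, ha, hb]
    · ext i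
      fin_cases i <;> simp [Matrix.vecMul, dotProduct, Fin.sum_univ_three] <;> linarith
  · rintro ⟨v, hv0, hv⟩
    have h0 := congrFun hv 0
    have h1 := congrFun hv 1
    have h2 := congrFun hv 2
    simp [Matrix.vecMul, dotProduct, Fin.sum_univ_three] at h0 h1 h2
    refine ⟨v 0 • lag1 p111 p112 p122 p222 + v 1 • lag2 p111 p112 p122 p222,
      Submodule.mem_inf.mpr ⟨Submodule.mem_span_pair.mpr ⟨v 0, v 1, rfl⟩,
        Submodule.mem_span_triple.mpr ⟨v 0, v 1, -v 2, ?_⟩⟩, fun hx => hv0 ?_⟩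
    · ext i
      fin_cases i <;> simp [lag1, lag2] <;> linarith
    · have ha := congrFun hx 0
      have hb := congrFun hx 1
      simp [lag1, lag2] at ha hb
      have hc : v 2 = 0 := by
        by_contra hc
        simp [ha, hb, hc] at h0 h1 h2
        exact hRST ⟨h0, h1, h2⟩
      ext i
      fin_cases i <;> simp [ha, hb, hc]
end

section
/- Let D ⊆ ℝ⁵ be a 3-dimensional subspace with basis w₁, w₂, w₃, and define F : ℝ⁴ → ℝ by F(p) = det of the 5×5 matrix with rows w₁, w₂, w₃, ℓ₁(p), ℓ₂(p). Then F is an affine function of p (i.e., there exist B ∈ ℝ⁴ and C ∈ ℝ with F(p) = B₁p₁₁₁ + B₂p₁₁₂ + B₃p₁₂₂ + B₄p₂₂₂ + C for all p) if and only if dim(D ∩ V₀) ≥ 2. -/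
/-- The vertical subspace `V₀ = {v ∈ ℝ⁵ : v₁ = v₂ = 0}`. -/
def vertical : Submodule ℝ (Fin 5 → ℝ) :=
  LinearMap.ker (LinearMap.proj (R := ℝ) (φ := fun _ : Fin 5 => ℝ) 0) ⊓
    LinearMap.ker (LinearMap.proj (R := ℝ) (φ := fun _ : Fin 5 => ℝ) 1)

/-- The `3 × 3` minor of the rows `w 0, w 1, w 2` on the columns `i, j, k`. -/
def columnMinor (w : Fin 3 → Fin 5 → ℝ) (i j k : Fin 5) : ℝ :=
  (w 1 i * w 2 j - w 2 i * w 1 j) * w 0 k + (w 2 i * w 0 j - w 0 i * w 2 j) * w 1 k +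
    (w 0 i * w 1 j - w 1 i * w 0 j) * w 2 k

theorem det_rows_eq (w : Fin 3 → Fin 5 → ℝ) (p : Fin 4 → ℝ) :
    Matrix.det (Matrix.of
        ![w 0, w 1, w 2, ![1, 0, p 0, p 1, p 2], ![0, 1, p 1, p 2, p 3]]) =
      columnMinor w 0 1 2 * (p 1 * p 3 - p 2 ^ 2) -
        columnMinor w 0 1 3 * (p 0 * p 3 - p 1 * p 2) +
        columnMinor w 0 1 4 * (p 0 * p 2 - p 1 ^ 2) +
      (-columnMinor w 0 3 4 * p 0 +
        (columnMinor w 0 2 4 - columnMinor w 1 3 4) * p 1 +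
        (columnMinor w 1 2 4 - columnMinor w 0 2 3) * p 2 +
        -columnMinor w 1 2 3 * p 3 + columnMinor w 2 3 4) := by
  simp [Matrix.det_succ_row_zero, Fin.sum_univ_succ, Fin.succAbove, columnMinor]
  ring

theorem exists_affine_iff_columnMinor_eq_zero (w : Fin 3 → Fin 5 → ℝ) :
    (∃ (B : Fin 4 → ℝ) (C : ℝ), ∀ p : Fin 4 → ℝ,
      Matrix.det (Matrix.of
        ![w 0, w 1, w 2, ![1, 0, p 0, p 1, p 2], ![0, 1, p 1, p 2, p 3]]) =
        B 0 * p 0 + B 1 * p 1 + B 2 * p 2 + B 3 * p 3 + C) ↔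
      columnMinor w 0 1 2 = 0 ∧ columnMinor w 0 1 3 = 0 ∧ columnMinor w 0 1 4 = 0 := by
  simp only [det_rows_eq]
  constructor
  · rintro ⟨B, C, h⟩
    have h₀ := h ![0, 0, 0, 0]
    have h₁ := h ![0, 1, 0, 0]
    have h₁' := h ![0, -1, 0, 0]
    have h₂ := h ![0, 0, 1, 0]
    have h₂' := h ![0, 0, -1, 0]
    have h₃ := h ![1, 0, 0, 1]
    have h₃' := h ![-1, 0, 0, -1]
    simp at h₀ h₁ h₁' h₂ h₂' h₃ h₃'
    refine ⟨?_, ?_, ?_⟩ <;> linarith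
  · rintro ⟨h₂, h₃, h₄⟩
    refine ⟨![-columnMinor w 0 3 4, columnMinor w 0 2 4 - columnMinor w 1 3 4,
      columnMinor w 1 2 4 - columnMinor w 0 2 3, -columnMinor w 1 2 3],
      columnMinor w 2 3 4, fun p => ?_⟩
    simp [h₂, h₃, h₄]

/-- For linearly independent rows, the minors containing the columns `0, 1` all vanish iff the
first two columns are proportional. -/
theorem columnMinor_eq_zero_iff {w : Fin 3 → Fin 5 → ℝ} (hw : LinearIndependent ℝ w) :
    (columnMinor w 0 1 2 = 0 ∧ columnMinor w 0 1 3 = 0 ∧ columnMinor w 0 1 4 = 0) ↔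
      w 1 0 * w 2 1 - w 2 0 * w 1 1 = 0 ∧ w 2 0 * w 0 1 - w 0 0 * w 2 1 = 0 ∧
        w 0 0 * w 1 1 - w 1 0 * w 0 1 = 0 := by
  constructor
  · rintro ⟨h₂, h₃, h₄⟩
    have h := Fintype.linearIndependent_iff.1 hw
      ![w 1 0 * w 2 1 - w 2 0 * w 1 1, w 2 0 * w 0 1 - w 0 0 * w 2 1,
        w 0 0 * w 1 1 - w 1 0 * w 0 1] (by
        ext k
        simp only [columnMinor] at h₂ h₃ h₄
        fin_cases k <;> simp [Fin.sum_univ_succ] <;> linarith)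
    exact ⟨h 0, h 1, h 2⟩
  · rintro ⟨h₀, h₁, h₂⟩
    simp [columnMinor, h₀, h₁, h₂]

/-- The first two coordinates of the linear combination of the `w i` with given coefficients. -/
noncomputable def horizontalPart (w : Fin 3 → Fin 5 → ℝ) : (Fin 3 → ℝ) →ₗ[ℝ] ℝ × ℝ :=
  ((LinearMap.proj 0).prod (LinearMap.proj 1)) ∘ₗ Fintype.linearCombination ℝ w

theorem horizontalPart_apply (w : Fin 3 → Fin 5 → ℝ) (x : Fin 3 → ℝ) :
    horizontalPart w x = (x 0 * w 0 0 + x 1 * w 1 0 + x 2 * w 2 0,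
      x 0 * w 0 1 + x 1 * w 1 1 + x 2 * w 2 1) := by
  simp [horizontalPart, Fintype.linearCombination_apply, Fin.sum_univ_three]

theorem finrank_span_inf_vertical {w : Fin 3 → Fin 5 → ℝ} (hw : LinearIndependent ℝ w) :
    Module.finrank ℝ ↥(Submodule.span ℝ (Set.range w) ⊓ vertical) =
      Module.finrank ℝ (LinearMap.ker (horizontalPart w)) := by
  have hinj : Function.Injective (Fintype.linearCombination ℝ w) :=
    linearIndependent_iff_injective_fintypeLinearCombination.1 hw
  have hmap : Submodule.span ℝ (Set.range w) ⊓ vertical =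
      (LinearMap.ker (horizontalPart w)).map (Fintype.linearCombination ℝ w) := by
    rw [horizontalPart, LinearMap.ker_comp, Submodule.map_comap_eq,
      Fintype.range_linearCombination, LinearMap.ker_prod, vertical]
  rw [hmap]
  exact (Submodule.equivMapOfInjective _ hinj _).finrank_eq.symm

theorem horizontalPart_surjective_iff (w : Fin 3 → Fin 5 → ℝ) :
    Function.Surjective (horizontalPart w) ↔
      ¬ (w 1 0 * w 2 1 - w 2 0 * w 1 1 = 0 ∧ w 2 0 * w 0 1 - w 0 0 * w 2 1 = 0 ∧
        w 0 0 * w 1 1 - w 1 0 * w 0 1 = 0) := by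
  constructor
  · rintro h ⟨h₀, h₁, h₂⟩
    obtain ⟨x, hx⟩ := h (1, 0)
    obtain ⟨y, hy⟩ := h (0, 1)
    rw [horizontalPart_apply, Prod.mk.injEq] at hx hy
    obtain ⟨hx₀, hx₁⟩ := hx
    obtain ⟨hy₀, hy₁⟩ := hy
    have key : (x 0 * w 0 0 + x 1 * w 1 0 + x 2 * w 2 0) *
          (y 0 * w 0 1 + y 1 * w 1 1 + y 2 * w 2 1) -
        (x 0 * w 0 1 + x 1 * w 1 1 + x 2 * w 2 1) *
          (y 0 * w 0 0 + y 1 * w 1 0 + y 2 * w 2 0) = 0 := by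
      linear_combination (x 1 * y 2 - x 2 * y 1) * h₀ + (x 2 * y 0 - x 0 * y 2) * h₁ +
        (x 0 * y 1 - x 1 * y 0) * h₂
    rw [hx₀, hx₁, hy₀, hy₁] at key
    norm_num at key
  · rintro h ⟨s, t⟩
    simp only [horizontalPart_apply, Prod.mk.injEq]
    rw [not_and_or, not_and_or] at h
    rcases h with h | h | h
    · generalize hd : w 1 0 * w 2 1 - w 2 0 * w 1 1 = d at h
      refine ⟨![0, (s * w 2 1 - t * w 2 0) / d,
        (t * w 1 0 - s * w 1 1) / d], ?_, ?_⟩ <;> simp <;> field_simp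
      · linear_combination s * hd
      · linear_combination t * hd
    · generalize hd : w 2 0 * w 0 1 - w 0 0 * w 2 1 = d at h
      refine ⟨![(t * w 2 0 - s * w 2 1) / d, 0,
        (s * w 0 1 - t * w 0 0) / d], ?_, ?_⟩ <;> simp <;> field_simp
      · linear_combination s * hd
      · linear_combination t * hd
    · generalize hd : w 0 0 * w 1 1 - w 1 0 * w 0 1 = d at h
      refine ⟨![(s * w 1 1 - t * w 1 0) / d,
        (t * w 0 0 - s * w 0 1) / d, 0], ?_, ?_⟩ <;> simp <;> field_simp
      · linear_combination s * hd
      · linear_combination t * hd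

theorem two_le_finrank_ker_iff_not_surjective (f : (Fin 3 → ℝ) →ₗ[ℝ] ℝ × ℝ) :
    2 ≤ Module.finrank ℝ (LinearMap.ker f) ↔ ¬ Function.Surjective f := by
  have hrank := f.finrank_range_add_finrank_ker
  have htop : Module.finrank ℝ (ℝ × ℝ) = 2 := by simp
  have hle := Submodule.finrank_le (LinearMap.range f)
  rw [Module.finrank_fin_fun] at hrank
  rw [← LinearMap.range_eq_top]
  constructor
  · intro h hsurj
    rw [hsurj, finrank_top] at hrank
    omega
  · intro h
    have := Submodule.finrank_lt h
    omega

/-- The Goursat-type equation `𝓔_D` of a 3-dimensional distribution `D ⊆ ℝ⁵` is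
quasi-linear (i.e. its defining 5×5 determinant is an affine function of the
`p_ijk`) if and only if the vertical part of `D` is (at least) 2-dimensional. -/
theorem goursat_quasilinear_iff_vertical_dim_ge_two
    (w : Fin 3 → (Fin 5 → ℝ)) (hw : LinearIndependent ℝ w)
    (D : Submodule ℝ (Fin 5 → ℝ)) (hD : D = Submodule.span ℝ (Set.range w))
    (F : (Fin 4 → ℝ) → ℝ)
    (hF : ∀ p : Fin 4 → ℝ,
      F p = Matrix.det (Matrix.of
        ![w 0, w 1, w 2,
          ![1, 0, p 0, p 1, p 2],
          ![0, 1, p 1, p 2, p 3]])) :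
    (∃ (B : Fin 4 → ℝ) (C : ℝ), ∀ p : Fin 4 → ℝ,
        F p = B 0 * p 0 + B 1 * p 1 + B 2 * p 2 + B 3 * p 3 + C) ↔
      2 ≤ Module.finrank ℝ ↥(D ⊓ vertical) := by
  subst hD
  simp only [hF]
  rw [exists_affine_iff_columnMinor_eq_zero, columnMinor_eq_zero_iff hw,
    finrank_span_inf_vertical hw, two_le_finrank_ker_iff_not_surjective,
    horizontalPart_surjective_iff, not_not]
end

section
/- For all real numbers k₁, k₂, k₃, for every permutation (i,j,l) of (1,2,3), and for all u ∈ D_i, v ∈ D_j, w ∈ D_l, one has Ω̃(u,v,w) = 0. In other words, the three distributions D₁, D₂, D₃ are mutually orthogonal with respect to the meta-symplectic trilinear form. -/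
/-- Coordinate expression of the meta-symplectic form `Ω = dp_{ij} ∧ dx^i ⊗ ∂p_j`
on ℝ⁵ (coordinates `D₁, D₂, ∂p₁₁, ∂p₁₂, ∂p₂₂`), with values in ℝ². -/
def metaOmega (u v : Fin 5 → ℝ) : Fin 2 → ℝ :=
  ![u 2 * v 0 - v 2 * u 0 + u 3 * v 1 - v 3 * u 1,
    u 3 * v 0 - v 3 * u 0 + u 4 * v 1 - v 4 * u 1]

/-- The trilinear form `Ω̃` obtained from `Ω` by pairing its value with the
horizontal part of the third argument. -/
def metaTri (u v w : Fin 5 → ℝ) : ℝ :=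
  metaOmega u v 0 * w 0 + metaOmega u v 1 * w 1

/-- Parametrisation of a vector of the characteristic distribution spanned by
`(1, κ, 0, 0, 0)`, `(0, 0, -(s - κ), 1, 0)` and `(0, 0, -t, κ, 1)`. -/
theorem exists_coords_of_mem_characteristic {κ s t : ℝ} {u : Fin 5 → ℝ}
    (hu : u ∈ Submodule.span ℝ {(![1, κ, 0, 0, 0] : Fin 5 → ℝ)} ⊔
      Submodule.span ℝ {![0, 0, -(s - κ), 1, 0], ![0, 0, -t, κ, 1]}) :
    ∃ a b c : ℝ, u = ![a, a * κ, -(b * (s - κ)) - c * t, b + c * κ, c] := by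
  obtain ⟨x, hx, y, hy, rfl⟩ := Submodule.mem_sup.1 hu
  obtain ⟨a, rfl⟩ := Submodule.mem_span_singleton.1 hx
  obtain ⟨b, c, rfl⟩ := Submodule.mem_span_pair.1 hy
  refine ⟨a, b, c, ?_⟩
  ext n
  fin_cases n <;> simp <;> ring

/-- Three-fold orthogonality: the three characteristic distributions `D₁, D₂, D₃`
of a quasi-linear 3rd-order MAE with completely decomposable symbol satisfy
`Ω̃(D_i, D_j, D_l) = 0` for every permutation `(i,j,l)` of `(1,2,3)`. -/
theorem three_fold_orthogonality
    (k1 k2 k3 : ℝ) (k : Fin 3 → ℝ) (hk : k = ![k1, k2, k3])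
    (σ1 σ2 : ℝ)
    (hσ1 : σ1 = k1 + k2 + k3) (hσ2 : σ2 = k1 * k2 + k1 * k3 + k2 * k3)
    (h : Fin 3 → (Fin 5 → ℝ)) (hh : ∀ m, h m = ![1, k m, 0, 0, 0])
    (V : Fin 3 → Submodule ℝ (Fin 5 → ℝ))
    (hV : ∀ m, V m = Submodule.span ℝ
      {![0, 0, -(σ1 - k m), 1, 0], ![0, 0, -σ2, k m, 1]})
    (D : Fin 3 → Submodule ℝ (Fin 5 → ℝ))
    (hD : ∀ m, D m = Submodule.span ℝ {h m} ⊔ V m)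
    (i j l : Fin 3) (hij : i ≠ j) (hil : i ≠ l) (hjl : j ≠ l) :
    ∀ u ∈ D i, ∀ v ∈ D j, ∀ w ∈ D l, metaTri u v w = 0 := by
  intro u hu v hv w hw
  have sum_eq : σ1 = k i + k j + k l ∧ σ2 = k i * k j + k i * k l + k j * k l := by
    subst hσ1 hσ2 hk
    fin_cases i <;> fin_cases j <;> fin_cases l <;> simp at hij hil hjl ⊢ <;>
      constructor <;> ring
  obtain ⟨h1, h2⟩ := sum_eq
  rw [hD, hh, hV] at hu hv hw
  obtain ⟨a, b, c, rfl⟩ := exists_coords_of_mem_characteristic hu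
  obtain ⟨a', b', c', rfl⟩ := exists_coords_of_mem_characteristic hv
  obtain ⟨a'', b'', c'', rfl⟩ := exists_coords_of_mem_characteristic hw
  simp only [metaTri, metaOmega, Matrix.cons_val]
  rw [h1, h2]
  ring
end

section
/- Let k₁, k₂, k₃ be pairwise distinct real numbers, let i ∈ {1,2,3}, let a, b ∈ ℝ with (a,b) ≠ (0,0), and let V̄ be a 2-dimensional subspace of the vertical subspace V₀ = {v ∈ ℝ⁵ : v₁ = v₂ = 0}. Let P ⊆ ℝ² be the image of V̄ under the linear map v ↦ Ω(h_i, v), and let Q ⊆ ℝ² be the image of V_i under the linear map v ↦ Ω((a,b,0,0,0), v). Then [P = Q and dim P = 1] if and only if there exists j ∈ {1,2,3} with j ≠ i such that span{(a,b,0,0,0)} + V̄ = D_j. -/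
/-- The meta-symplectic form `Ω` on ℝ⁵, as a linear map in its second argument
(values in ℝ²). -/
def metaOmegaL (u : Fin 5 → ℝ) : (Fin 5 → ℝ) →ₗ[ℝ] (Fin 2 → ℝ) where
  toFun v := ![u 2 * v 0 - v 2 * u 0 + u 3 * v 1 - v 3 * u 1,
               u 3 * v 0 - v 3 * u 0 + u 4 * v 1 - v 4 * u 1]
  map_add' x y := by
    funext i; fin_cases i <;> simp <;> ring
  map_smul' c x := by
    funext i; fin_cases i <;> simp <;> ring

theorem metaOmegaL_vertical_apply (a b : ℝ) (v : Fin 5 → ℝ) :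
    metaOmegaL ![a, b, 0, 0, 0] v = ![-(a * v 2 + b * v 3), -(a * v 3 + b * v 4)] := by
  ext i; fin_cases i <;> simp [metaOmegaL] <;> ring

theorem mem_vertical {v : Fin 5 → ℝ} : v ∈ vertical ↔ v 0 = 0 ∧ v 1 = 0 := by
  simp [vertical]

/-- The plane in the vertical space spanned by `(0, 0, q², -q, 1)` and `(0, 0, r², -r, 1)` when
`q ≠ r`. -/
def charPlane (q r : ℝ) : Submodule ℝ (Fin 5 → ℝ) :=
  Submodule.span ℝ {![0, 0, -(q + r), 1, 0], ![0, 0, -(q * r), 0, 1]}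

theorem mem_charPlane {q r : ℝ} {v : Fin 5 → ℝ} :
    v ∈ charPlane q r ↔ v 0 = 0 ∧ v 1 = 0 ∧ v 2 + (q + r) * v 3 + q * r * v 4 = 0 := by
  rw [charPlane, Submodule.mem_span_pair]
  constructor
  · rintro ⟨s, t, rfl⟩
    refine ⟨by simp, by simp, ?_⟩
    simp
    ring
  · rintro ⟨h0, h1, h2⟩
    refine ⟨v 3, v 4, ?_⟩
    ext i; fin_cases i <;> simp [h0, h1]
    linarith

theorem charPlane_comm (q r : ℝ) : charPlane q r = charPlane r q := by
  rw [charPlane, charPlane, add_comm, mul_comm]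

theorem span_eq_charPlane {σ1 σ2 p q r : ℝ} (h1 : σ1 = p + q + r)
    (h2 : σ2 = p * q + p * r + q * r) :
    Submodule.span ℝ {![0, 0, -(σ1 - p), 1, 0], ![0, 0, -σ2, p, 1]} = charPlane q r := by
  subst h1 h2
  ext v
  rw [mem_charPlane, Submodule.mem_span_pair]
  constructor
  · rintro ⟨s, t, rfl⟩
    refine ⟨by simp, by simp, ?_⟩
    simp
    ring
  · rintro ⟨h0, h1, h2⟩
    refine ⟨v 3 - p * v 4, v 4, ?_⟩
    ext i; fin_cases i <;> simp [h0, h1]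
    · linear_combination -h2
    · ring

theorem finrank_charPlane_le (q r : ℝ) : Module.finrank ℝ (charPlane q r) ≤ 2 := by
  classical
  have h := finrank_span_finset_le_card (R := ℝ)
    ({![0, 0, -(q + r), 1, 0], ![0, 0, -(q * r), 0, 1]} : Finset (Fin 5 → ℝ))
  rw [Finset.coe_pair] at h
  exact h.trans Finset.card_le_two

theorem eq_charPlane_of_le {q r : ℝ} {W : Submodule ℝ (Fin 5 → ℝ)}
    (hW : Module.finrank ℝ W = 2) (h : W ≤ charPlane q r) : W = charPlane q r :=
  Submodule.eq_of_le_of_finrank_le h (hW ▸ finrank_charPlane_le q r)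

theorem map_metaOmegaL_charPlane {a p r : ℝ} (ha : a ≠ 0) (hpr : p ≠ r) :
    Submodule.map (metaOmegaL ![a, a * p, 0, 0, 0]) (charPlane p r) =
      Submodule.span ℝ {![r, -1]} := by
  ext w
  simp only [Submodule.mem_map, mem_charPlane, Submodule.mem_span_singleton,
    metaOmegaL_vertical_apply]
  constructor
  · rintro ⟨v, ⟨-, -, h⟩, rfl⟩
    refine ⟨a * (v 3 + p * v 4), ?_⟩
    ext i; fin_cases i <;> simp
    · linear_combination a * h
    · ring
  · rintro ⟨c, rfl⟩
    have hd : p - r ≠ 0 := sub_ne_zero.2 hpr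
    refine ⟨(c / (a * (p - r))) • ![0, 0, r ^ 2, -r, 1], ⟨by simp, by simp, ?_⟩, ?_⟩
    · simp
      ring
    · ext i; fin_cases i <;> simp <;> field_simp <;> ring

theorem map_eq_iff_eq_charPlane {a p q r : ℝ} (ha : a ≠ 0) (hpr : p ≠ r) (hqr : q ≠ r)
    {W : Submodule ℝ (Fin 5 → ℝ)} (hWv : W ≤ vertical) (hW : Module.finrank ℝ W = 2) :
    Submodule.map (metaOmegaL ![1, p, 0, 0, 0]) W =
      Submodule.map (metaOmegaL ![a, a * q, 0, 0, 0]) (charPlane q r) ↔ W = charPlane p r := by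
  rw [map_metaOmegaL_charPlane ha hqr]
  constructor
  · intro h
    refine eq_charPlane_of_le hW fun v hv => ?_
    have hm := h ▸ Submodule.mem_map_of_mem (f := metaOmegaL ![1, p, 0, 0, 0]) hv
    rw [Submodule.mem_span_singleton, metaOmegaL_vertical_apply] at hm
    obtain ⟨c, hc⟩ := hm
    have e0 := congrFun hc 0
    have e1 := congrFun hc 1
    simp at e0 e1
    obtain ⟨h0, h1⟩ := mem_vertical.1 (hWv hv)
    exact mem_charPlane.2 ⟨h0, h1, by linear_combination e0 + r * e1⟩
  · rintro rfl
    simpa using map_metaOmegaL_charPlane one_ne_zero hpr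

theorem span_sup_eq_iff {a b p q r : ℝ} (hab : ¬(a = 0 ∧ b = 0))
    {W : Submodule ℝ (Fin 5 → ℝ)} (hWv : W ≤ vertical) (hW : Module.finrank ℝ W = 2) :
    Submodule.span ℝ {![a, b, 0, 0, 0]} ⊔ W = Submodule.span ℝ {![1, q, 0, 0, 0]} ⊔ charPlane p r ↔
      b = a * q ∧ W = charPlane p r := by
  constructor
  · intro h
    have key : ∀ v ∈ Submodule.span ℝ {![a, b, 0, 0, 0]} ⊔ W,
        v 1 = v 0 * q ∧ (v 0 = 0 → v ∈ charPlane p r) := by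
      rw [h]
      intro v hv
      obtain ⟨x, hx, y, hy, rfl⟩ := Submodule.mem_sup.1 hv
      obtain ⟨c, rfl⟩ := Submodule.mem_span_singleton.1 hx
      obtain ⟨h0, h1, -⟩ := mem_charPlane.1 hy
      refine ⟨by simp [h0, h1], fun hc => ?_⟩
      have hc' : c = 0 := by simpa [h0] using hc
      simpa [hc'] using hy
    refine ⟨?_, eq_charPlane_of_le hW fun v hv => ?_⟩
    · simpa using (key _ (Submodule.mem_sup_left (Submodule.mem_span_singleton_self _))).1
    · exact (key v (Submodule.mem_sup_right hv)).2 (mem_vertical.1 (hWv hv)).1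
  · rintro ⟨rfl, rfl⟩
    have ha : a ≠ 0 := fun ha => hab (by simp [ha])
    have e : (![a, a * q, 0, 0, 0] : Fin 5 → ℝ) = a • ![1, q, 0, 0, 0] := by simp
    rw [e, Submodule.span_singleton_smul_eq ha.isUnit]

theorem eq_mul_or_eq_mul_of_finrank_map {a b q r : ℝ} (hqr : q ≠ r)
    (h : Module.finrank ℝ
      (Submodule.map (metaOmegaL ![a, b, 0, 0, 0]) (charPlane q r)) = 1) :
    b = a * q ∨ b = a * r := by
  obtain ⟨w, -, hw⟩ := finrank_eq_one_iff'.1 h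
  have memq : ![0, 0, q ^ 2, -q, 1] ∈ charPlane q r :=
    mem_charPlane.2 ⟨by simp, by simp, by simp; ring⟩
  have memr : ![0, 0, r ^ 2, -r, 1] ∈ charPlane q r :=
    mem_charPlane.2 ⟨by simp, by simp, by simp; ring⟩
  obtain ⟨s, hs⟩ := hw ⟨_, Submodule.mem_map_of_mem memq⟩
  obtain ⟨t, ht⟩ := hw ⟨_, Submodule.mem_map_of_mem memr⟩
  have hs := congrArg Subtype.val hs
  have ht := congrArg Subtype.val ht
  have s0 := congrFun hs 0
  have s1 := congrFun hs 1
  have t0 := congrFun ht 0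
  have t1 := congrFun ht 1
  simp [metaOmegaL_vertical_apply] at s0 s1 t0 t1
  have hdet : (b - a * q) * (b - a * r) * (q - r) = 0 := by
    generalize (w : Fin 2 → ℝ) 0 = x at *
    generalize (w : Fin 2 → ℝ) 1 = y at *
    have e : (s * x) * (t * y) = (s * y) * (t * x) := by ring
    rw [s0, s1, t0, t1] at e
    linear_combination -e
  rcases mul_eq_zero.1 hdet with h | h
  · exact (mul_eq_zero.1 h).imp sub_eq_zero.1 sub_eq_zero.1
  · exact absurd (sub_eq_zero.1 h) hqr

theorem orthogonal_iff_of_pairwise_ne {a b p q r : ℝ} (hpq : p ≠ q) (hpr : p ≠ r) (hqr : q ≠ r)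
    (hab : ¬(a = 0 ∧ b = 0)) {W : Submodule ℝ (Fin 5 → ℝ)} (hWv : W ≤ vertical)
    (hW : Module.finrank ℝ W = 2) :
    (Submodule.map (metaOmegaL ![1, p, 0, 0, 0]) W =
        Submodule.map (metaOmegaL ![a, b, 0, 0, 0]) (charPlane q r) ∧
      Module.finrank ℝ (Submodule.map (metaOmegaL ![1, p, 0, 0, 0]) W) = 1) ↔
    (Submodule.span ℝ {![a, b, 0, 0, 0]} ⊔ W =
        Submodule.span ℝ {![1, q, 0, 0, 0]} ⊔ charPlane p r ∨
      Submodule.span ℝ {![a, b, 0, 0, 0]} ⊔ W =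
        Submodule.span ℝ {![1, r, 0, 0, 0]} ⊔ charPlane p q) := by
  have ha (t : ℝ) (hb : b = a * t) : a ≠ 0 := fun ha => hab (by simp [ha, hb])
  rw [span_sup_eq_iff hab hWv hW, span_sup_eq_iff hab hWv hW]
  constructor
  · rintro ⟨h, h1⟩
    refine (eq_mul_or_eq_mul_of_finrank_map hqr (h ▸ h1)).imp (fun hb => ⟨hb, ?_⟩)
      (fun hb => ⟨hb, ?_⟩)
    · rw [hb] at h
      exact (map_eq_iff_eq_charPlane (ha q hb) hpr hqr hWv hW).1 h
    · rw [hb, charPlane_comm] at h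
      exact (map_eq_iff_eq_charPlane (ha r hb) hpq hqr.symm hWv hW).1 h
  · have fin (t : ℝ) : Module.finrank ℝ (Submodule.span ℝ {(![t, -1] : Fin 2 → ℝ)}) = 1 :=
      finrank_span_singleton fun h => by simpa using congrFun h 1
    rintro (⟨hb, h⟩ | ⟨hb, h⟩)
    · have e := (map_eq_iff_eq_charPlane (ha q hb) hpr hqr hWv hW).2 h
      rw [hb]
      exact ⟨e, by rw [e, map_metaOmegaL_charPlane (ha q hb) hqr, fin]⟩
    · have e := (map_eq_iff_eq_charPlane (ha r hb) hpq hqr.symm hWv hW).2 h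
      rw [hb, charPlane_comm q r]
      exact ⟨e, by rw [e, map_metaOmegaL_charPlane (ha r hb) hqr.symm, fin]⟩

/-- The distributions orthogonal, in the meta-symplectic sense
`Ω(h_i, D̄^v) = Ω(h̄, D_i^v) = 1-dimensional space`, to a characteristic
distribution `D_i` of a quasi-linear 3rd-order MAE with completely decomposable
symbol are exactly the other two characteristic distributions `D_j`, `j ≠ i`. -/
theorem orthogonal_complement_characterization
    (k1 k2 k3 : ℝ) (hk12 : k1 ≠ k2) (hk13 : k1 ≠ k3) (hk23 : k2 ≠ k3)
    (k : Fin 3 → ℝ) (hk : k = ![k1, k2, k3])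
    (σ1 σ2 : ℝ)
    (hσ1 : σ1 = k1 + k2 + k3) (hσ2 : σ2 = k1 * k2 + k1 * k3 + k2 * k3)
    (h : Fin 3 → (Fin 5 → ℝ)) (hh : ∀ m, h m = ![1, k m, 0, 0, 0])
    (V : Fin 3 → Submodule ℝ (Fin 5 → ℝ))
    (hV : ∀ m, V m = Submodule.span ℝ
      {![0, 0, -(σ1 - k m), 1, 0], ![0, 0, -σ2, k m, 1]})
    (D : Fin 3 → Submodule ℝ (Fin 5 → ℝ))
    (hD : ∀ m, D m = Submodule.span ℝ {h m} ⊔ V m)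
    (i : Fin 3) (a b : ℝ) (hab : ¬(a = 0 ∧ b = 0))
    (Vbar : Submodule ℝ (Fin 5 → ℝ)) (hVbar : Vbar ≤ vertical)
    (hVbar2 : Module.finrank ℝ Vbar = 2)
    (P Q : Submodule ℝ (Fin 2 → ℝ))
    (hP : P = Submodule.map (metaOmegaL (h i)) Vbar)
    (hQ : Q = Submodule.map (metaOmegaL ![a, b, 0, 0, 0]) (V i)) :
    (P = Q ∧ Module.finrank ℝ P = 1) ↔
      ∃ j : Fin 3, j ≠ i ∧ Submodule.span ℝ {![a, b, 0, 0, 0]} ⊔ Vbar = D j := by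
  obtain rfl := funext hh
  subst hk hP hQ
  have hV0 : V 0 = charPlane k2 k3 :=
    (hV 0).trans (span_eq_charPlane (p := k1) hσ1 hσ2)
  have hV1 : V 1 = charPlane k1 k3 :=
    (hV 1).trans (span_eq_charPlane (p := k2) (by rw [hσ1]; ring) (by rw [hσ2]; ring))
  have hV2 : V 2 = charPlane k1 k2 :=
    (hV 2).trans (span_eq_charPlane (p := k3) (by rw [hσ1]; ring) (by rw [hσ2]; ring))
  match i with
  | 0 =>
    rw [hV0]
    refine (orthogonal_iff_of_pairwise_ne hk12 hk13 hk23 hab hVbar hVbar2).trans ?_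
    simp [Fin.exists_fin_succ, hD, hV1, hV2]
  | 1 =>
    rw [hV1]
    refine (orthogonal_iff_of_pairwise_ne hk12.symm hk23 hk13 hab hVbar hVbar2).trans ?_
    simp [Fin.exists_fin_succ, hD, hV0, hV2, charPlane_comm k2 k1]
  | 2 =>
    rw [hV2]
    refine (orthogonal_iff_of_pairwise_ne hk13.symm hk23.symm hk12 hab hVbar hVbar2).trans ?_
    simp [Fin.exists_fin_succ, hD, hV0, hV1, charPlane_comm k3]
end

section
/- Let k₁, k₂ ∈ ℝ and let {i,j} = {1,2}. Set X₁ = (0,0,−k₁k₂,0,1) and X₂ = (0,0,k₁+k₂,1,0) in ℝ⁵. For X ∈ ℝ⁵ let φᵢ(X) : ℝ² → ℝ be the linear functional φᵢ(X)(w₁,w₂) = Ω(X,(w₁,w₂,0,0,0))₁ − kᵢ·Ω(X,(w₁,w₂,0,0,0))₂. Then the subspace {φᵢ(X) : X ∈ span{X₁,X₂}} of the dual of ℝ² equals the line spanned by the nonzero functional (w₁,w₂) ↦ k_j·w₁ + w₂; in particular it is 1-dimensional. -/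
/-- On the combination `a X₁ + b X₂`, the form composed with the quotient by the line `(s, 1)`
is the multiple `b - s a` of the functional `w ↦ t w₀ + w₁`. -/
theorem metaOmega_kernel_combination (s t a b : ℝ) (w : Fin 2 → ℝ) :
    metaOmega (a • ![0, 0, -(s * t), 0, 1] + b • ![0, 0, s + t, 1, 0])
        ![w 0, w 1, 0, 0, 0] 0 -
      s * metaOmega (a • ![0, 0, -(s * t), 0, 1] + b • ![0, 0, s + t, 1, 0])
        ![w 0, w 1, 0, 0, 0] 1 =
      (b - s * a) * (t * w 0 + w 1) := by
  simp [metaOmega]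
  ring


/-- The quotient `(V ⌟ Ω)/Hᵢ` is the 1-dimensional space spanned by the nonzero
functional `(w₁,w₂) ↦ k_j·w₁ + w₂`: here `V = span{X₁,X₂}` is the kernel, inside
the vertical space, of the decomposable covector
`ω = dp₁₁ − (k₁+k₂)dp₁₂ + k₁k₂dp₂₂`, and `φᵢ(X)` realizes `Ω(X,·)` composed with
the quotient by the characteristic line `Hᵢ = ∂p₂ + kᵢ∂p₁`. -/
theorem quotient_by_characteristic_line_one_dimensional
    (k1 k2 : ℝ) (k : Fin 2 → ℝ) (hk : k = ![k1, k2])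
    (i j : Fin 2) (hij : i ≠ j)
    (X1 X2 : Fin 5 → ℝ)
    (hX1 : X1 = ![0, 0, -(k1 * k2), 0, 1])
    (hX2 : X2 = ![0, 0, k1 + k2, 1, 0])
    (φ : (Fin 5 → ℝ) → (Fin 2 → ℝ) → ℝ)
    (hφ : ∀ X w, φ X w =
      metaOmega X ![w 0, w 1, 0, 0, 0] 0 - k i * metaOmega X ![w 0, w 1, 0, 0, 0] 1) :
    {f : (Fin 2 → ℝ) → ℝ | ∃ X ∈ Submodule.span ℝ ({X1, X2} : Set (Fin 5 → ℝ)), f = φ X} =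
      {f : (Fin 2 → ℝ) → ℝ | ∃ c : ℝ, f = fun w => c * (k j * w 0 + w 1)} ∧
    (fun w : Fin 2 → ℝ => k j * w 0 + w 1) ≠ 0 := by
  have hsum : k1 + k2 = k i + k j := by
    fin_cases i <;> fin_cases j <;> simp_all [add_comm]
  have hprod : k1 * k2 = k i * k j := by
    fin_cases i <;> fin_cases j <;> simp_all [mul_comm]
  have hφ_comb (a b : ℝ) :
      φ (a • X1 + b • X2) = fun w => (b - k i * a) * (k j * w 0 + w 1) := by
    funext w
    rw [hφ, hX1, hX2, hsum, hprod, metaOmega_kernel_combination]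
  refine ⟨Set.ext fun f => ⟨?_, ?_⟩, fun h => ?_⟩
  · rintro ⟨X, hX, rfl⟩
    obtain ⟨a, b, rfl⟩ := Submodule.mem_span_pair.mp hX
    exact ⟨_, hφ_comb a b⟩
  · rintro ⟨c, rfl⟩
    refine ⟨(0 : ℝ) • X1 + c • X2, Submodule.mem_span_pair.mpr ⟨0, c, rfl⟩, ?_⟩
    simp only [hφ_comb, mul_zero, sub_zero]
  · simpa using congrFun h ![0, 1]
end

section
/- Let k₁, k₂, k₁₁, k₁₂, k₂₂, h₁, h₂, h₁₁, h₁₂, h₂₂ and p₁₁₁, p₁₁₂, p₁₂₂, p₂₂₂ be real numbers, and set Δ = (h₁₁k₂₂ − k₁₁h₂₂)p₂₂₂ + (h₁₁k₁₂ − k₁₁h₁₂)p₁₂₂ + h₁₁k₂ − k₁₁h₂. Suppose Δ ≠ 0 and that β, G ∈ ℝ satisfy the two equations k₁ + k₁₂p₁₁₂ + k₂₂p₁₂₂ + (k₂ + k₁₁p₁₁₂ + k₁₂p₁₂₂ + k₂₂p₂₂₂)β + k₁₁G = 0 and h₁ + h₁₂p₁₁₂ + h₂₂p₁₂₂ + (h₂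 + h₁₁p₁₁₂ + h₁₂p₁₂₂ + h₂₂p₂₂₂)β + h₁₁G = 0. Then −Δ(p₁₁₁ − G) = −h₁k₂ + k₁h₂ − (h₁₁k₂ − k₁₁h₂)p₁₁₁ − (k₁₁h₁ − h₁₁k₁ + k₂h₁₂ − k₁₂h₂)p₁₁₂ − (k₂h₂₂ + k₁₂h₁ − k₂₂h₂ − k₁h₁₂)p₁₂₂ − (k₂₂h₁ − k₁h₂₂)p₂₂₂ + (k₁₂h₂₂ − h₁₂k₂₂)(p₁₁₂p₂₂₂ − p₁₂₂²) + (k₂₂h₁₁ − k₁₁h₂₂)(−p₁₁₁p₂₂₂ + p₁₁₂p₁₂₂) + (k₁₁h₁₂ − h₁₁k₁₂)(p₁₁₁p₁₂₂ − p₁₁₂²). -/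
/-- The elimination identity (eqDeltaPi111MenoGi): solving the linear system for
the characteristic slope `β` and the right-hand side `G` exhibits `p₁₁₁ − G` as a
Monge–Ampère expression whose coefficients are the 2×2 minors of the coefficient
matrix of the annihilating forms `ρ₁, ρ₂`. -/
theorem elimination_identity
    (k1 k2 k11 k12 k22 h1 h2 h11 h12 h22 p111 p112 p122 p222 : ℝ)
    (Δ : ℝ)
    (hΔdef : Δ = (h11 * k22 - k11 * h22) * p222 + (h11 * k12 - k11 * h12) * p122
        + h11 * k2 - k11 * h2)
    (hΔ : Δ ≠ 0) (β G : ℝ)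
    (heq1 : k1 + k12 * p112 + k22 * p122
        + (k2 + k11 * p112 + k12 * p122 + k22 * p222) * β + k11 * G = 0)
    (heq2 : h1 + h12 * p112 + h22 * p122
        + (h2 + h11 * p112 + h12 * p122 + h22 * p222) * β + h11 * G = 0) :
    -Δ * (p111 - G) =
      -h1 * k2 + k1 * h2 - (h11 * k2 - k11 * h2) * p111
      - (k11 * h1 - h11 * k1 + k2 * h12 - k12 * h2) * p112
      - (k2 * h22 + k12 * h1 - k22 * h2 - k1 * h12) * p122
      - (k22 * h1 - k1 * h22) * p222
      + (k12 * h22 - h12 * k22) * (p112 * p222 - p122 ^ 2)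
      + (k22 * h11 - k11 * h22) * (-(p111 * p222) + p112 * p122)
      + (k11 * h12 - h11 * k12) * (p111 * p122 - p112 ^ 2) := by
  rw [hΔdef]
  linear_combination (k2 + k11 * p112 + k12 * p122 + k22 * p222) * heq2
    - (h2 + h11 * p112 + h12 * p122 + h22 * p222) * heq1
end
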